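/- Let m = 3 and ℳ = (3^{i−1})_{i≥1}. For all integers k ≥ 1 and n ≥ 0, writing c_j = ⌊n/3^j⌋ mod 3 for the j-th base-3 digit of n: p_ℳ(n,k) ≡ 1 (mod 3) if and only if c_j ∈ {0,1} for all 1 ≤ j ≤ k−1 and the number of indices j ∈ {1,…,k−1} with c_j = 1 is even; and p_ℳ(n,k) ≡ 2 (mod 3) if and only if c_j ∈ {0,1} for all 1 ≤ j ≤ k−1 and the number of indices j ∈ {1,…,k−1} with c_j = 1 is odd. -/

import Mathlib

/-- `pM m k n` is the number of restricted `m`-ary partitions of `n` with parts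
`1, m, m^2, …, m^(k-1)`. -/
noncomputable def pM (m k n : ℕ) : ℕ :=
  Nat.card {x : Fin k → ℕ // ∑ i : Fin k, x i * m ^ (i : ℕ) = n}

theorem finite_pM_solutions {m : ℕ} (hm : 0 < m) (k n : ℕ) :
    Finite {x : Fin k → ℕ // ∑ i : Fin k, x i * m ^ (i : ℕ) = n} := by
  refine Set.Finite.subset (Set.finite_Iic (fun _ : Fin k => n)) fun x hx i => ?_
  calc x i ≤ x i * m ^ (i : ℕ) := Nat.le_mul_of_pos_right _ (pow_pos hm _)
    _ ≤ ∑ i : Fin k, x i * m ^ (i : ℕ) :=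
      Finset.single_le_sum (f := fun i : Fin k => x i * m ^ (i : ℕ))
        (fun _ _ => Nat.zero_le _) (Finset.mem_univ i)
    _ = n := hx

theorem sum_mul_pow_succ (m k : ℕ) (x : Fin (k + 1) → ℕ) :
    ∑ i : Fin (k + 1), x i * m ^ (i : ℕ) =
      x 0 + m * ∑ i : Fin k, x i.succ * m ^ (i : ℕ) := by
  rw [Fin.sum_univ_succ, Finset.mul_sum]
  simp only [Fin.val_zero, pow_zero, mul_one, Fin.val_succ]
  congr 1
  exact Finset.sum_congr rfl fun i _ => by ring

/-- Removing the parts equal to `1` leaves `m` times a partition of some `i ≤ n / m`. -/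
def pMSolutionsEquiv {m : ℕ} (hm : 0 < m) (k n : ℕ) :
    {x : Fin (k + 1) → ℕ // ∑ i : Fin (k + 1), x i * m ^ (i : ℕ) = n} ≃
      Σ s : Fin (n / m + 1), {y : Fin k → ℕ // ∑ i : Fin k, y i * m ^ (i : ℕ) = s} where
  toFun x := ⟨⟨∑ i : Fin k, x.1 i.succ * m ^ (i : ℕ), by
    have h := x.2
    rw [sum_mul_pow_succ] at h
    rw [Nat.lt_succ_iff, Nat.le_div_iff_mul_le hm, mul_comm]
    omega⟩, fun i => x.1 i.succ, rfl⟩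
  invFun y := ⟨Fin.cons (n - m * y.1) y.2.1, by
    have h : (y.1 : ℕ) * m ≤ n := (Nat.le_div_iff_mul_le hm).1 (Nat.lt_succ_iff.1 y.1.2)
    rw [mul_comm] at h
    rw [sum_mul_pow_succ]
    simp only [Fin.cons_zero, Fin.cons_succ, y.2.2]
    omega⟩
  left_inv x := by
    have h := x.2
    rw [sum_mul_pow_succ] at h
    apply Subtype.ext
    funext i
    refine Fin.cases ?_ (fun i => ?_) i
    · simp only [Fin.cons_zero]
      omega
    · simp only [Fin.cons_succ]
  right_inv y := by
    obtain ⟨⟨s, hs⟩, y, hy⟩ := y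
    change _ = s at hy
    subst hy
    rfl

theorem pM_succ {m : ℕ} (hm : 0 < m) (k n : ℕ) :
    pM m (k + 1) n = ∑ i ∈ Finset.range (n / m + 1), pM m k i := by
  have := finite_pM_solutions hm k
  rw [pM, Nat.card_congr (pMSolutionsEquiv hm k n), Nat.card_sigma, Finset.sum_range]
  rfl

theorem pM_zero_right (m n : ℕ) : pM m 0 n = if n = 0 then 1 else 0 := by
  split_ifs with h
  · subst h
    simp [pM]
  · simp [pM, Ne.symm h]

theorem sum_range_succ_eq_of_div_congr {m : ℕ} (f : ℕ → ZMod m)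
    (hf : ∀ i j, i / m = j / m → f i = f j) (n : ℕ) :
    ∑ i ∈ Finset.range (n + 1), f i = (n + 1) * f n := by
  induction n with
  | zero => simp
  | succ n ih =>
    rw [Finset.sum_range_succ, ih]
    by_cases h : m ∣ n + 1
    · have h0 : ((n + 1 : ℕ) : ZMod m) = 0 := (ZMod.natCast_eq_zero_iff _ _).2 h
      push_cast at h0 ⊢
      rw [h0]
      ring
    · rw [hf n (n + 1) (Nat.succ_div_of_not_dvd h).symm]
      push_cast
      ring

theorem pM_succ_cast {m : ℕ} (hm : 0 < m) (k n : ℕ) :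
    (pM m (k + 1) n : ZMod m) =
      ∏ j ∈ Finset.range k, (((n / m ^ (j + 1) : ℕ) : ZMod m) + 1) := by
  induction k generalizing n with
  | zero => simp [pM_succ hm, pM_zero_right]
  | succ k ih =>
    rw [pM_succ hm, Nat.cast_sum, sum_range_succ_eq_of_div_congr, ih, Finset.prod_range_succ',
      mul_comm]
    · simp [Nat.div_div_eq_div_mul, pow_succ']
    · intro i j hij
      simp only [ih, pow_succ', ← Nat.div_div_eq_div_mul, hij]

theorem prod_natCast_add_one_of_forall {s : Finset ℕ} {c : ℕ → ℕ}
    (h : ∀ j ∈ s, c j % 3 = 0 ∨ c j % 3 = 1) :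
    ∏ j ∈ s, ((c j : ZMod 3) + 1) = (-1) ^ (s.filter fun j => c j % 3 = 1).card := by
  rw [← Finset.prod_const, Finset.prod_filter]
  refine Finset.prod_congr rfl fun j hj => ?_
  rw [← ZMod.natCast_mod (c j) 3]
  rcases h j hj with h | h <;> rw [h]
  · simp
  · decide

theorem prod_natCast_add_one_of_not_forall {s : Finset ℕ} {c : ℕ → ℕ}
    (h : ¬ ∀ j ∈ s, c j % 3 = 0 ∨ c j % 3 = 1) :
    ∏ j ∈ s, ((c j : ZMod 3) + 1) = 0 := by
  push Not at h
  obtain ⟨j, hj, h0, h1⟩ := h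
  refine Finset.prod_eq_zero hj ?_
  rw [← ZMod.natCast_mod (c j) 3, show c j % 3 = 2 by omega]
  decide

theorem stmt_10 (k : ℕ) (hk : 1 ≤ k) (n : ℕ) :
    (pM 3 k n % 3 = 1 ↔
      (∀ j ∈ Finset.Icc 1 (k - 1), n / 3 ^ j % 3 = 0 ∨ n / 3 ^ j % 3 = 1) ∧
      Even ((Finset.Icc 1 (k - 1)).filter (fun j => n / 3 ^ j % 3 = 1)).card) ∧
    (pM 3 k n % 3 = 2 ↔
      (∀ j ∈ Finset.Icc 1 (k - 1), n / 3 ^ j % 3 = 0 ∨ n / 3 ^ j % 3 = 1) ∧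
      Odd ((Finset.Icc 1 (k - 1)).filter (fun j => n / 3 ^ j % 3 = 1)).card) := by
  have hprod : (pM 3 k n : ZMod 3) =
      ∏ j ∈ Finset.Icc 1 (k - 1), (((n / 3 ^ j : ℕ) : ZMod 3) + 1) := by
    obtain ⟨k, rfl⟩ := Nat.exists_eq_add_of_le' hk
    rw [pM_succ_cast three_pos, Finset.range_eq_Ico,
      Finset.prod_Ico_add' (fun j => (((n / 3 ^ j : ℕ) : ZMod 3) + 1)) 0 k 1]
    rfl
  have hmod (a : ℕ) (ha : a < 3) : pM 3 k n % 3 = a ↔ (pM 3 k n : ZMod 3) = a := by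
    rw [ZMod.natCast_eq_natCast_iff', Nat.mod_eq_of_lt ha]
  rw [hmod 1 (by norm_num), hmod 2 (by norm_num), hprod]
  by_cases h : ∀ j ∈ Finset.Icc 1 (k - 1), n / 3 ^ j % 3 = 0 ∨ n / 3 ^ j % 3 = 1
  · rw [prod_natCast_add_one_of_forall h]
    simp only [and_iff_right h]
    rcases Nat.even_or_odd
      ((Finset.Icc 1 (k - 1)).filter (fun j => n / 3 ^ j % 3 = 1)).card with he | ho
    · rw [he.neg_one_pow]
      simp only [he, Nat.not_odd_iff_even.2 he]
      decide
    · rw [ho.neg_one_pow]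
      simp only [ho, Nat.not_even_iff_odd.2 ho]
      decide
  · rw [prod_natCast_add_one_of_not_forall h]
    simp only [h, false_and]
    decide
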